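/- Write N = 2n + r with r ∈ {0,1}. For every M ∈ M_N(ℂ) with zero diagonal and M • M = 0, there exists an involution π of {1,…,N} with exactly r fixed points such that (M²)_{ii} = (M²)_{π(i)π(i)} for all i = 1,…,N, and (M²)_{ii} = 0 whenever π(i) = i; here M² denotes the ordinary matrix square. (The nonzero diagonal entries of the ordinary square of an element of the Brauer loop scheme come in equal pairs, matched by a link pattern.) -/

import Mathlib

open Matrix BigOperators Finset

/-- `cyc3 i j k` : the sequence `(i,j,k)` of indices is cyclically ordered `⟨i ≤ j ≤ k⟩`,
i.e. some cyclic rotation of it is weakly increasing, with all entries required to be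
equal when the first and last entries coincide. -/
def cyc3 {N : ℕ} (i j k : Fin N) : Prop :=
  if i = k then j = i
  else (i ≤ j ∧ j ≤ k) ∨ (j ≤ k ∧ k ≤ i) ∨ (k ≤ i ∧ i ≤ j)

instance cyc3.dec {N : ℕ} (i j k : Fin N) : Decidable (cyc3 i j k) := by
  unfold cyc3; infer_instance

/-- The degenerate product `•` on `N × N` complex matrices:
`(P • Q)_{ik} = ∑_{j : ⟨i ≤ j ≤ k⟩} P_{ij} Q_{jk}`. -/
noncomputable def cprod {N : ℕ} (P Q : Matrix (Fin N) (Fin N) ℂ) :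
    Matrix (Fin N) (Fin N) ℂ :=
  Matrix.of fun i k => ∑ j ∈ Finset.univ.filter (fun j => cyc3 i j k), P i j * Q j k

/-- If every nonzero value of `y` is attained an even number of times on `S`, then the elements
of `S` can be paired so that `y` is constant on pairs, leaving at most one unpaired element, at
which `y` vanishes. -/
theorem exists_involutive_of_even_fibers {α β : Type*} [DecidableEq α] [DecidableEq β] [Zero β]
    (y : α → β) (S : Finset α)
    (hS : ∀ c, c ≠ 0 → Even (S.filter (fun i => y i = c)).card) :
    ∃ g : α → α, Function.Involutive g ∧ (∀ i ∉ S, g i = i) ∧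
      (S.filter (fun i => g i = i)).card = S.card % 2 ∧
      (∀ i, y i = y (g i)) ∧ (∀ i ∈ S, g i = i → y i = 0) := by
  induction S using Finset.strongInduction with
  | H S ih =>
    by_cases h : ∃ a ∈ S, ∃ b ∈ S, a ≠ b ∧ y a = y b
    · obtain ⟨a, ha, b, hb, hab, hy⟩ := h
      obtain ⟨T, haT, hbT, rfl⟩ : ∃ T : Finset α, a ∉ insert b T ∧ b ∉ T ∧
          S = insert a (insert b T) := by
        refine ⟨(S.erase a).erase b, ?_, ?_, ?_⟩
        · simp [hab]
        · simp
        · rw [Finset.insert_erase (by simp [hb, hab.symm]), Finset.insert_erase ha]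
      have haT' : a ∉ T := fun h => haT (Finset.mem_insert_of_mem h)
      obtain ⟨g, hinv, hfix, hcard, hyg, hzero⟩ := ih T
        (Finset.ssubset_iff_subset_ne.mpr ⟨fun x hx => by simp [hx],
          fun h => haT' (h ▸ Finset.mem_insert_self a _)⟩) (by
          intro c hc
          have key := hS c hc
          rw [Finset.filter_insert, Finset.filter_insert, ← hy] at key
          split_ifs at key with hac
          · rw [Finset.card_insert_of_notMem (by simp [hab, haT']),
              Finset.card_insert_of_notMem (by simp [hbT])] at key
            grind
          · exact key)
      have hga : g a = a := hfix a haT'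
      have hgb : g b = b := hfix b hbT
      refine ⟨fun x => if x = a then b else if x = b then a else g x, ?_, ?_, ?_, ?_, ?_⟩
      · intro x
        have := hinv x
        grind
      · grind
      · rw [Finset.filter_insert, Finset.filter_insert, Finset.card_insert_of_notMem haT,
          Finset.card_insert_of_notMem hbT]
        simp only [if_true, hab, hab.symm, if_false]
        rw [add_assoc, Nat.add_mod_right, ← hcard]
        congr 1
        exact Finset.filter_congr fun x hx => by grind
      · grind
      · grind
    · push Not at h
      have hy : ∀ i ∈ S, y i = 0 := by
        intro i hi
        by_contra hne
        have h1 : S.filter (fun j => y j = y i) = {i} := by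
          ext j
          simp only [Finset.mem_filter, Finset.mem_singleton]
          grind
        have h2 := hS _ hne
        rw [h1] at h2
        simp at h2
      have hle : S.card ≤ 1 := Finset.card_le_one.mpr fun a ha b hb => by
        by_contra hab
        exact h a ha b hb hab ((hy a ha).trans (hy b hb).symm)
      refine ⟨id, fun _ => rfl, fun _ _ => rfl, ?_, fun _ => rfl, fun i hi _ => hy i hi⟩
      simp only [id, Finset.filter_true]
      omega

open Polynomial in
/-- If `U ^ 2 = 0`, the generalized eigenspaces of `U L + L U` at nonzero eigenvalues are
even-dimensional, because `U` restricts to them with kernel equal to its range. -/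
theorem even_finrank_maxGenEigenspace_anticommutator {K V : Type*} [Field K] [AddCommGroup V]
    [Module K V] [FiniteDimensional K V] (U L : Module.End K V) (hU : U * U = 0)
    {c : K} (hc : c ≠ 0) :
    Even (Module.finrank K (Module.End.maxGenEigenspace (U * L + L * U) c)) := by
  set D : Module.End K V := U * L + L * U with hD
  set W := Module.End.maxGenEigenspace D c
  have hcomm : Commute D U := by
    change D * U = U * D
    rw [hD, add_mul, mul_add, mul_assoc L U U, hU, ← mul_assoc U U L, hU]
    simp [mul_assoc]
  have hmaps : ∀ v ∈ W, U v ∈ W := Module.End.mapsTo_maxGenEigenspace_of_comm hcomm c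
  set f := U.restrict hmaps with hf
  have hker : LinearMap.ker f = LinearMap.range f := by
    apply le_antisymm
    · rintro ⟨v, hv⟩ hfv
      have hUv : U v = 0 := by
        have := congrArg Subtype.val (LinearMap.mem_ker.mp hfv)
        simpa [hf] using this
      obtain ⟨q, hq, hqc⟩ := D.charpoly.exists_eq_pow_rootMultiplicity_mul_and_not_dvd
        D.charpoly_monic.ne_zero c
      obtain ⟨k, hk⟩ := (Module.End.mem_maxGenEigenspace D c v).mp hv
      have hcop : IsCoprime ((X - C c) ^ k) (q * X) := by
        apply IsCoprime.pow_left
        rw [(irreducible_X_sub_C c).coprime_iff_not_dvd]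
        intro hdvd
        rcases (prime_X_sub_C c).dvd_or_dvd hdvd with h | h
        · exact hqc h
        · rw [dvd_iff_isRoot] at h
          exact hc (by simpa using h)
      obtain ⟨a, b, hab⟩ := hcop
      have hmem : aeval D (b * q) (L v) ∈ W := by
        rw [Module.End.mem_maxGenEigenspace]
        refine ⟨D.charpoly.rootMultiplicity c, ?_⟩
        have h0 : aeval D ((X - C c) ^ D.charpoly.rootMultiplicity c * (b * q)) = 0 := by
          rw [mul_left_comm, ← hq, map_mul, LinearMap.aeval_self_charpoly, mul_zero]
        have := LinearMap.congr_fun h0 (L v)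
        simpa [Algebra.algebraMap_eq_smul_one] using this
      refine ⟨⟨_, hmem⟩, Subtype.ext ?_⟩
      have hDv : D v = U (L v) := by simp [hD, hUv]
      have hcU : Commute (aeval D (b * q)) U := by
        rw [aeval_eq_sum_range]
        exact Commute.sum_left _ _ _ fun i _ => (hcomm.pow_left i).smul_left _
      have h1 : aeval D (b * q) (D v) = v := by
        have := LinearMap.congr_fun (congrArg (aeval D) hab) v
        have hk' : (aeval D ((X - C c) ^ k)) v = 0 := by
          simpa [Algebra.algebraMap_eq_smul_one] using hk
        rw [map_add, map_mul, ← mul_assoc, map_mul _ (b * q) X] at this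
        simpa only [LinearMap.add_apply, Module.End.mul_apply, hk', map_zero, zero_add, aeval_X,
          map_one, Module.End.one_apply] using this
      change U (aeval D (b * q) (L v)) = v
      rw [← Module.End.mul_apply, ← hcU.eq, Module.End.mul_apply, ← hDv, h1]
    · rintro _ ⟨w, rfl⟩
      exact Subtype.ext (LinearMap.congr_fun hU w)
  have := LinearMap.finrank_range_add_finrank_ker f
  rw [hker] at this
  exact ⟨_, this.symm⟩

/-- If `U ^ 2 = 0` and `U L + L U` is upper triangular, every nonzero value occurs an even number
of times on the diagonal of `U L + L U`. -/
theorem even_card_diag_anticommutator {K n : Type*} [Field K] [DecidableEq K] [Fintype n]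
    [LinearOrder n] (U L : Matrix n n K) (hU : U * U = 0)
    (hD : (U * L + L * U).BlockTriangular id) {c : K} (hc : c ≠ 0) :
    Even (Finset.univ.filter (fun i => (U * L + L * U) i i = c)).card := by
  have h := even_finrank_maxGenEigenspace_anticommutator (Matrix.toLin' U) (Matrix.toLin' L)
    (by rw [Module.End.mul_eq_comp, ← Matrix.toLin'_mul, hU, map_zero]) hc
  rw [Module.End.mul_eq_comp, Module.End.mul_eq_comp, ← Matrix.toLin'_mul, ← Matrix.toLin'_mul,
    ← map_add, LinearMap.finrank_maxGenEigenspace_eq, Matrix.charpoly_toLin',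
    Matrix.charpoly_of_isUpperTriangular _ hD, ← Polynomial.count_roots,
    Polynomial.roots_prod _ _ (Finset.prod_ne_zero_iff.mpr fun i _ => Polynomial.X_sub_C_ne_zero _)]
    at h
  simp only [Polynomial.roots_X_sub_C, Multiset.bind_singleton, Multiset.count_map] at h
  simpa only [eq_comm, Finset.card_def, Finset.filter_val] using h

/-- The ordinary square of a matrix with zero diagonal and `M • M = 0` has on its diagonal every
nonzero value an even number of times. -/
theorem even_card_diag_sq_of_cprod_eq_zero {N : ℕ} (M : Matrix (Fin N) (Fin N) ℂ)
    (hdiag : ∀ i, M i i = 0) (hMM : cprod M M = 0) {c : ℂ} (hc : c ≠ 0) :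
    Even (Finset.univ.filter (fun i => (M * M) i i = c)).card := by
  set U : Matrix (Fin N) (Fin N) ℂ := Matrix.of fun i j => if i < j then M i j else 0 with hUdef
  set L : Matrix (Fin N) (Fin N) ℂ := Matrix.of fun i j => if j < i then M i j else 0 with hLdef
  have hentry : ∀ i k, ∑ j, (if cyc3 i j k then M i j * M j k else 0) = 0 := by
    intro i k
    rw [← Finset.sum_filter]
    exact congrFun (congrFun hMM i) k
  have hU : U * U = 0 := by
    ext i k
    rw [Matrix.mul_apply, Matrix.zero_apply]
    rcases lt_or_ge i k with hik | hik
    · rw [← hentry i k]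
      refine Finset.sum_congr rfl fun j _ => ?_
      have := hdiag j
      simp only [hUdef, Matrix.of_apply, cyc3]
      grind
    · refine Finset.sum_eq_zero fun j _ => ?_
      simp only [hUdef, Matrix.of_apply]
      grind
  have hD : (U * L + L * U).BlockTriangular id := by
    intro i k hki
    simp only [id] at hki
    rw [Matrix.add_apply, Matrix.mul_apply, Matrix.mul_apply, ← Finset.sum_add_distrib,
      ← hentry i k]
    refine Finset.sum_congr rfl fun j _ => ?_
    have := hdiag j
    simp only [hUdef, hLdef, Matrix.of_apply, cyc3]
    grind
  have hdiagonal : ∀ i, (U * L + L * U) i i = (M * M) i i := by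
    intro i
    rw [Matrix.add_apply, Matrix.mul_apply, Matrix.mul_apply, Matrix.mul_apply,
      ← Finset.sum_add_distrib]
    refine Finset.sum_congr rfl fun j _ => ?_
    have := hdiag j
    simp only [hUdef, hLdef, Matrix.of_apply]
    grind
  simpa only [hdiagonal] using even_card_diag_anticommutator U L hU hD hc

/-- Write `N = 2n + r`, `r ∈ {0,1}`, so `r = N % 2`.  For every `M` in the Brauer loop
scheme (`M` has zero diagonal and `M • M = 0`) there is a link pattern `π` — an
involution of the indices with exactly `r` fixed points — such that
`(M²)_{ii} = (M²)_{π(i)π(i)}` for all `i`, and `(M²)_{ii} = 0` whenever `π(i) = i`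
(ordinary matrix squares): the nonzero diagonal entries of `M²` come in equal pairs. -/
theorem brauer_diag_paired (N : ℕ) (hN : 0 < N)
    (M : Matrix (Fin N) (Fin N) ℂ)
    (hdiag : ∀ i, M i i = 0) (hMM : cprod M M = 0) :
    ∃ π : Equiv.Perm (Fin N),
      (∀ i, π (π i) = i) ∧
      (Finset.univ.filter (fun i => π i = i)).card = N % 2 ∧
      (∀ i, (M * M) i i = (M * M) (π i) (π i)) ∧
      (∀ i, π i = i → (M * M) i i = 0) := by
  obtain ⟨g, hinv, -, hcard, hy, hzero⟩ := exists_involutive_of_even_fibers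
    (fun i => (M * M) i i) Finset.univ
    fun c hc => even_card_diag_sq_of_cprod_eq_zero M hdiag hMM hc
  refine ⟨hinv.toPerm, hinv, ?_, hy, fun i => hzero i (Finset.mem_univ i)⟩
  convert hcard using 2
  · ext i
    rw [Finset.mem_filter, Finset.mem_filter]
    rfl
  · simp
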